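/- Let (N, ∘_λ, ∗_λ) be a Novikov–Poisson conformal superalgebra. Define [a_λ b] := a ∗_λ b − (−1)^{|a||b|} (b ∗_{−∂−λ} a) for homogeneous a, b ∈ N. Then (N, ∘_λ, [·_λ ·]) is a transposed Poisson conformal superalgebra. -/

import Mathlib

open Polynomial
open scoped TensorProduct

noncomputable section

namespace TPCSAFormal

/-- The super-sign `(-1)^{i·j}` for parities `i, j ∈ ℤ/2ℤ`. -/
def sgn (i j : ZMod 2) : ℂ := (-1 : ℂ) ^ (i.val * j.val)

variable (L : Type*) [AddCommGroup L] [Module ℂ L]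
  [Module (Polynomial ℂ) L] [IsScalarTower ℂ (Polynomial ℂ) L]

/-- A conformal `λ`-product on the `ℂ[∂]`-module `L`, recorded by its family of `n`-th
product coefficients: `a ∘_λ b = ∑_n λ^n • coeff n a b`, with finitely many nonzero terms.
This is exactly the data of a `ℂ`-bilinear map `L ⊗ L → ℂ[λ] ⊗ L`. -/
structure ConformalProduct where
  coeff : ℕ → L →ₗ[ℂ] L →ₗ[ℂ] L
  coeff_finite : ∀ a b : L, ∃ N : ℕ, ∀ n : ℕ, N ≤ n → coeff n a b = 0

variable {L}

/-- The value `a ∘_λ b` of the `λ`-product at `λ ∈ ℂ`.  Since `ℂ` is infinite, identities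
between such values for all `λ` are equivalent to the corresponding polynomial identities. -/
def ConformalProduct.mul (m : ConformalProduct L) (lam : ℂ) (a b : L) : L :=
  ∑ᶠ n : ℕ, lam ^ n • m.coeff n a b

/-- The value `a ∘_{-∂-λ} b`, where `∂` acts on `L` as scalar multiplication by
`X ∈ ℂ[∂]` (the variable `λ` being replaced by the operator `-∂-λ`). -/
def ConformalProduct.cmul (m : ConformalProduct L) (lam : ℂ) (a b : L) : L :=
  ∑ᶠ n : ℕ, ((-((X : Polynomial ℂ) + C lam)) ^ n) • m.coeff n a b

variable (L) in
/-- A `ℤ₂`-grading on `L` making it a `ℤ₂`-graded `ℂ[∂]`-module: `L = L₀ ⊕ L₁` with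
`∂ L_i ⊆ L_i`, where `∂` acts as multiplication by `X ∈ ℂ[∂]`. -/
structure SuperModule where
  grade : ZMod 2 → Submodule ℂ L
  isInternal : DirectSum.IsInternal grade
  X_smul_mem : ∀ (i : ZMod 2) (a : L), a ∈ grade i → (X : Polynomial ℂ) • a ∈ grade i

/-- `m` is an even `λ`-product on the `ℤ₂`-graded `ℂ[∂]`-module `(L, S)`:
it is even with respect to the grading and conformally sesquilinear. -/
structure IsLambdaProduct (S : SuperModule L) (m : ConformalProduct L) : Prop where
  even : ∀ (i j : ZMod 2) (a b : L), a ∈ S.grade i → b ∈ S.grade j →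
    ∀ n : ℕ, m.coeff n a b ∈ S.grade (i + j)
  sesq_left : ∀ (lam : ℂ) (a b : L),
    m.mul lam ((X : Polynomial ℂ) • a) b = (-lam) • m.mul lam a b
  sesq_right : ∀ (lam : ℂ) (a b : L),
    m.mul lam a ((X : Polynomial ℂ) • b) =
      (X : Polynomial ℂ) • m.mul lam a b + lam • m.mul lam a b

/-- `(L, S, m)` is a commutative associative conformal superalgebra. -/
structure IsCommAssoc (S : SuperModule L) (m : ConformalProduct L)
    extends IsLambdaProduct S m : Prop where
  comm : ∀ (i j : ZMod 2) (a b : L), a ∈ S.grade i → b ∈ S.grade j →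
    ∀ lam : ℂ, m.mul lam a b = sgn i j • m.cmul lam b a
  assoc : ∀ (lam mu : ℂ) (a b c : L),
    m.mul lam a (m.mul mu b c) = m.mul (lam + mu) (m.mul lam a b) c

/-- `(L, S, br)` is a Lie conformal superalgebra. -/
structure IsLie (S : SuperModule L) (br : ConformalProduct L)
    extends IsLambdaProduct S br : Prop where
  skew : ∀ (i j : ZMod 2) (a b : L), a ∈ S.grade i → b ∈ S.grade j →
    ∀ lam : ℂ, br.mul lam a b = -(sgn i j • br.cmul lam b a)
  jacobi : ∀ (i j : ZMod 2) (a b : L), a ∈ S.grade i → b ∈ S.grade j →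
    ∀ (c : L) (lam mu : ℂ),
      br.mul lam a (br.mul mu b c) =
        br.mul (lam + mu) (br.mul lam a b) c + sgn i j • br.mul mu b (br.mul lam a c)

/-- `(L, S, m, br)` is a transposed Poisson conformal superalgebra. -/
structure IsTPCSA (S : SuperModule L) (m br : ConformalProduct L) : Prop where
  commAssoc : IsCommAssoc S m
  lie : IsLie S br
  transposedLeibniz : ∀ (i j : ZMod 2) (a b : L), a ∈ S.grade i → b ∈ S.grade j →
    ∀ (c : L) (lam mu : ℂ),
      (2 : ℂ) • m.mul lam a (br.mul mu b c) =
        br.mul (lam + mu) (m.mul lam a b) c + sgn i j • br.mul mu b (m.mul lam a c)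

/-- `(L, S, m, br)` is a Poisson conformal superalgebra. -/
structure IsPCSA (S : SuperModule L) (m br : ConformalProduct L) : Prop where
  commAssoc : IsCommAssoc S m
  lie : IsLie S br
  leibniz : ∀ (i j : ZMod 2) (a b : L), a ∈ S.grade i → b ∈ S.grade j →
    ∀ (c : L) (lam mu : ℂ),
      br.mul lam a (m.mul mu b c) =
        m.mul (lam + mu) (br.mul lam a b) c + sgn i j • m.mul mu b (br.mul lam a c)

/-- `(L, S, br, α)` is a Hom-Lie conformal superalgebra. -/
structure IsHomLie (S : SuperModule L) (br : ConformalProduct L) (α : L → L)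
    extends IsLambdaProduct S br : Prop where
  map_smul_add : ∀ (c : ℂ) (a b : L), α (c • a + b) = c • α a + α b
  map_grade : ∀ (i : ZMod 2) (a : L), a ∈ S.grade i → α a ∈ S.grade i
  commute_partial : ∀ a : L, α ((X : Polynomial ℂ) • a) = (X : Polynomial ℂ) • α a
  skew : ∀ (i j : ZMod 2) (a b : L), a ∈ S.grade i → b ∈ S.grade j →
    ∀ lam : ℂ, br.mul lam a b = -(sgn i j • br.cmul lam b a)
  homJacobi : ∀ (i j : ZMod 2) (a b : L), a ∈ S.grade i → b ∈ S.grade j →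
    ∀ (c : L) (lam mu : ℂ),
      br.mul lam (α a) (br.mul mu b c) =
        br.mul (lam + mu) (br.mul lam a b) (α c) + sgn i j • br.mul mu (α b) (br.mul lam a c)

/-- `(L, S, p)` is a left-symmetric conformal superalgebra. -/
structure IsLeftSymmetric (S : SuperModule L) (p : ConformalProduct L)
    extends IsLambdaProduct S p : Prop where
  leftSym : ∀ (i j : ZMod 2) (a b : L), a ∈ S.grade i → b ∈ S.grade j →
    ∀ (c : L) (lam mu : ℂ),
      p.mul (lam + mu) (p.mul lam a b) c - p.mul lam a (p.mul mu b c) =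
        sgn i j • (p.mul (lam + mu) (p.mul mu b a) c - p.mul mu b (p.mul lam a c))

/-- `(L, S, p)` is a (left) Novikov conformal superalgebra. -/
structure IsNovikov (S : SuperModule L) (p : ConformalProduct L)
    extends IsLeftSymmetric S p : Prop where
  novikov : ∀ (j k : ZMod 2) (b c : L), b ∈ S.grade j → c ∈ S.grade k →
    ∀ (a : L) (lam mu : ℂ),
      p.mul (lam + mu) (p.mul lam a b) c = sgn j k • p.cmul mu (p.mul lam a c) b

/-- `(L, S, mc, p)` is a Novikov-Poisson conformal superalgebra. -/
structure IsNovikovPoisson (S : SuperModule L) (mc p : ConformalProduct L) : Prop where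
  commAssoc : IsCommAssoc S mc
  novikov : IsNovikov S p
  compat₁ : ∀ (lam mu : ℂ) (a b c : L),
    p.mul (lam + mu) (mc.mul lam a b) c = mc.mul lam a (p.mul mu b c)
  compat₂ : ∀ (i j : ZMod 2) (a b : L), a ∈ S.grade i → b ∈ S.grade j →
    ∀ (c : L) (lam mu : ℂ),
      mc.mul (lam + mu) (p.mul lam a b) c - p.mul lam a (mc.mul mu b c) =
        sgn i j • (mc.mul (lam + mu) (p.mul mu b a) c - p.mul mu b (mc.mul lam a c))

/-- `(L, S, mc, p)` is a pre-Lie commutative conformal superalgebra. -/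
structure IsPreLieComm (S : SuperModule L) (mc p : ConformalProduct L) : Prop where
  commAssoc : IsCommAssoc S mc
  leftSymmetric : IsLeftSymmetric S p
  compat : ∀ (i j : ZMod 2) (a b : L), a ∈ S.grade i → b ∈ S.grade j →
    ∀ (c : L) (lam mu : ℂ),
      p.mul lam a (mc.mul mu b c) =
        mc.mul (lam + mu) (p.mul lam a b) c + sgn i j • mc.mul mu b (p.mul lam a c)

/-- `(L, S, mc, p)` is a pre-Lie Poisson conformal superalgebra. -/
structure IsPreLiePoisson (S : SuperModule L) (mc p : ConformalProduct L) : Prop where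
  commAssoc : IsCommAssoc S mc
  leftSymmetric : IsLeftSymmetric S p
  compat₁ : ∀ (lam mu : ℂ) (a b c : L),
    p.mul (lam + mu) (mc.mul lam a b) c = mc.mul lam a (p.mul mu b c)
  compat₂ : ∀ (i j : ZMod 2) (a b : L), a ∈ S.grade i → b ∈ S.grade j →
    ∀ (c : L) (lam mu : ℂ),
      mc.mul (lam + mu) (p.mul lam a b) c - p.mul lam a (mc.mul mu b c) =
        sgn i j • (mc.mul (lam + mu) (p.mul mu b a) c - p.mul mu b (mc.mul lam a c))


/-- The `ℂ`-linear map `∑ λ^n v_n ↦ ∑ x^n • f v_n`. -/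
def evalMap (x : ℂ[X]) (f : L →ₗ[ℂ] L) : (ℕ →₀ L) →ₗ[ℂ] L :=
  Finsupp.lsum ℂ fun n => (Algebra.lsmul ℂ ℂ L (x ^ n)) ∘ₗ f

theorem evalMap_single (x : ℂ[X]) (f : L →ₗ[ℂ] L) (n : ℕ) (v : L) :
    evalMap x f (Finsupp.single n v) = x ^ n • f v := by
  rw [evalMap, Finsupp.lsum_single, LinearMap.comp_apply, Algebra.lsmul_coe]

theorem evalMap_add (x : ℂ[X]) (f g : L →ₗ[ℂ] L) (v : ℕ →₀ L) :
    evalMap x (f + g) v = evalMap x f v + evalMap x g v := by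
  induction v using Finsupp.induction_linear with
  | zero => simp
  | add u v hu hv => rw [map_add, map_add, map_add, hu, hv]; abel
  | single n v => simp [evalMap_single, smul_add]

theorem evalMap_sub (x : ℂ[X]) (f g : L →ₗ[ℂ] L) (v : ℕ →₀ L) :
    evalMap x (f - g) v = evalMap x f v - evalMap x g v := by
  induction v using Finsupp.induction_linear with
  | zero => simp
  | add u v hu hv => simp only [map_add, hu, hv]; abel
  | single n v => simp [evalMap_single, smul_sub]

theorem evalMap_smul (x : ℂ[X]) (s : ℂ) (f : L →ₗ[ℂ] L) (v : ℕ →₀ L) :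
    evalMap x (s • f) v = s • evalMap x f v := by
  induction v using Finsupp.induction_linear with
  | zero => simp
  | add u v hu hv => simp only [map_add, hu, hv, smul_add]
  | single n v => simp only [evalMap_single, LinearMap.smul_apply, smul_comm _ s]

theorem evalMap_congr (x : ℂ[X]) {f g : L →ₗ[ℂ] L} (v : ℕ →₀ L)
    (h : ∀ n, f (v n) = g (v n)) : evalMap x f v = evalMap x g v := by
  simp only [evalMap, Finsupp.lsum_apply, Finsupp.sum]
  exact Finset.sum_congr rfl fun n _ => by simp [h n]

/-- Multiplication of an `L`-valued polynomial by its variable. -/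
def shift : (ℕ →₀ L) →ₗ[ℂ] (ℕ →₀ L) := Finsupp.lmapDomain L ℂ Nat.succ

theorem evalMap_shift (x : ℂ[X]) (f : L →ₗ[ℂ] L) (v : ℕ →₀ L) :
    evalMap x f (shift v) = x • evalMap x f v := by
  induction v using Finsupp.induction_linear with
  | zero => simp
  | add u v hu hv => simp only [map_add, hu, hv, smul_add]
  | single n v =>
    simp [shift, Finsupp.mapDomain_single, evalMap_single, pow_succ', mul_smul]

/-- A function `ℂ[∂] → L` that is polynomial in its argument. -/
def IsPoly (f : ℂ[X] → L) : Prop := ∃ v : ℕ →₀ L, ∀ x, f x = evalMap x LinearMap.id v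

namespace IsPoly

theorem const (v : L) : IsPoly fun _ : ℂ[X] => v :=
  ⟨Finsupp.single 0 v, fun x => by simp [evalMap_single]⟩

theorem add {f g : ℂ[X] → L} (hf : IsPoly f) (hg : IsPoly g) :
    IsPoly fun x => f x + g x := by
  obtain ⟨u, hu⟩ := hf
  obtain ⟨v, hv⟩ := hg
  exact ⟨u + v, fun x => by simp only [map_add, hu, hv]⟩

theorem csmul {f : ℂ[X] → L} (hf : IsPoly f) (s : ℂ) : IsPoly fun x => s • f x := by
  obtain ⟨u, hu⟩ := hf
  exact ⟨s • u, fun x => by simp only [map_smul, hu]⟩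

theorem sub {f g : ℂ[X] → L} (hf : IsPoly f) (hg : IsPoly g) :
    IsPoly fun x => f x - g x := by
  obtain ⟨u, hu⟩ := hf
  obtain ⟨v, hv⟩ := hg
  exact ⟨u - v, fun x => by simp only [map_sub, hu, hv]⟩

theorem self_smul {f : ℂ[X] → L} (hf : IsPoly f) : IsPoly fun x => x • f x := by
  obtain ⟨u, hu⟩ := hf
  exact ⟨shift u, fun x => by simp only [evalMap_shift, hu]⟩

theorem const_smul {f : ℂ[X] → L} (hf : IsPoly f) (r : ℂ[X]) : IsPoly fun x => r • f x := by
  obtain ⟨u, hu⟩ := hf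
  refine ⟨Finsupp.mapRange.linearMap (Algebra.lsmul ℂ ℂ L r) u, fun x => ?_⟩
  simp only [hu]
  clear hu
  induction u using Finsupp.induction_linear with
  | zero => simp
  | add u v hu hv => simp only [map_add, ← hu, ← hv, smul_add]
  | single n v => simp [evalMap_single, smul_comm r]

theorem add_smul {f : ℂ[X] → L} (hf : IsPoly f) (r : ℂ[X]) :
    IsPoly fun x => (x + r) • f x := by
  simpa only [_root_.add_smul] using hf.self_smul.add (hf.const_smul r)

theorem pow_smul {f : ℂ[X] → L} {q : ℂ[X] → ℂ[X]}
    (hq : ∀ g : ℂ[X] → L, IsPoly g → IsPoly fun x => q x • g x) (hf : IsPoly f) (n : ℕ) :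
    IsPoly fun x => q x ^ n • f x := by
  induction n with
  | zero => simpa using hf
  | succ n ih => simpa only [pow_succ', mul_smul] using hq _ ih

theorem evalMap {q : ℂ[X] → ℂ[X]}
    (hq : ∀ g : ℂ[X] → L, IsPoly g → IsPoly fun x => q x • g x)
    {F : ℂ[X] → L →ₗ[ℂ] L} (hF : ∀ v, IsPoly fun x => F x v) (v : ℕ →₀ L) :
    IsPoly fun x => evalMap (q x) (F x) v := by
  induction v using Finsupp.induction_linear with
  | zero => simpa using const (0 : L)
  | add u v hu hv => simpa only [map_add] using hu.add hv
  | single n v => simpa only [evalMap_single] using pow_smul hq (hF v) n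

end IsPoly

theorem C_smul_eq (r : ℂ) (v : L) : (C r : ℂ[X]) • v = r • v :=
  algebraMap_smul ℂ[X] r v

theorem eq_zero_of_evalMap_C (v : ℕ →₀ L)
    (h : ∀ r : ℂ, evalMap (C r) LinearMap.id v = 0) : v = 0 := by
  ext n
  rw [Finsupp.zero_apply, ← Module.forall_dual_apply_eq_zero_iff ℂ]
  intro φ
  let P : (ℕ →₀ L) →ₗ[ℂ] ℂ[X] := Finsupp.lsum ℂ fun k => (monomial k).comp φ
  have eval_P : ∀ (r : ℂ) (u : ℕ →₀ L), (P u).eval r = φ (evalMap (C r) LinearMap.id u) := by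
    intro r u
    induction u using Finsupp.induction_linear with
    | zero => simp
    | add u v hu hv => simp only [map_add, eval_add, hu, hv]
    | single k w =>
      rw [evalMap_single, ← C_pow, C_smul_eq]
      simp [P, mul_comm]
  have coeff_P : ∀ u : ℕ →₀ L, (P u).coeff n = φ (u n) := by
    intro u
    induction u using Finsupp.induction_linear with
    | zero => simp
    | add u v hu hv => simp only [map_add, coeff_add, hu, hv, Finsupp.add_apply]
    | single k w =>
      simp only [P, Finsupp.lsum_single, LinearMap.comp_apply, coeff_monomial,
        Finsupp.single_apply]
      split_ifs <;> simp
  have hP : P v = 0 := Polynomial.funext fun r => by rw [eval_P, h, map_zero, eval_zero]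
  rw [← coeff_P, hP, coeff_zero]

theorem IsPoly.eq_of_forall_C {f g : ℂ[X] → L} (hf : IsPoly f) (hg : IsPoly g)
    (h : ∀ r : ℂ, f (C r) = g (C r)) (x : ℂ[X]) : f x = g x := by
  obtain ⟨v, hv⟩ := hf.sub hg
  have h0 : v = 0 := eq_zero_of_evalMap_C v fun r => by simp only [← hv, h, sub_self]
  rw [← sub_eq_zero]
  exact (hv x).trans (by rw [h0, map_zero])

/-- The substitution `λ ↦ -∂-λ` applied to `λ^n v`. -/
def substMonomial : ℕ → L →ₗ[ℂ] (ℕ →₀ L)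
  | 0 => Finsupp.lsingle 0
  | n + 1 => -((substMonomial n).comp (Algebra.lsmul ℂ ℂ L (X : ℂ[X])) +
      shift.comp (substMonomial n))

/-- The substitution `λ ↦ -∂-λ` on `L`-valued polynomials. -/
def subst : (ℕ →₀ L) →ₗ[ℂ] (ℕ →₀ L) := Finsupp.lsum ℂ substMonomial

theorem evalMap_substMonomial {f : L →ₗ[ℂ] L} {r x y : ℂ[X]}
    (hf : ∀ v, f ((X : ℂ[X]) • v) = r • f v) (h : x + y = -r) (n : ℕ) (v : L) :
    evalMap x f (substMonomial n v) = y ^ n • f v := by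
  induction n generalizing v with
  | zero => simp [substMonomial, evalMap_single]
  | succ n ih =>
    obtain rfl : y = -(r + x) := by linear_combination h
    simp only [substMonomial, LinearMap.neg_apply, LinearMap.add_apply, LinearMap.comp_apply,
      map_neg, map_add, evalMap_shift, Algebra.lsmul_coe, ih, hf]
    module

theorem evalMap_subst {f : L →ₗ[ℂ] L} {r x y : ℂ[X]}
    (hf : ∀ v, f ((X : ℂ[X]) • v) = r • f v) (h : x + y = -r) (v : ℕ →₀ L) :
    evalMap x f (subst v) = evalMap y f v := by
  induction v using Finsupp.induction_linear with
  | zero => simp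
  | add u v hu hv => simp only [map_add, hu, hv]
  | single n v => simp [subst, evalMap_substMonomial hf h, evalMap_single]

theorem subst_mem {V : Submodule ℂ L} (hV : ∀ v ∈ V, (X : ℂ[X]) • v ∈ V) {v : ℕ →₀ L}
    (hv : ∀ n, v n ∈ V) (k : ℕ) : subst v k ∈ V := by
  have mono : ∀ (n k : ℕ), ∀ w ∈ V, substMonomial n w k ∈ V := by
    intro n
    induction n with
    | zero =>
      intro k w hw
      simp only [substMonomial, Finsupp.lsingle_apply, Finsupp.single_apply]
      split_ifs
      exacts [hw, V.zero_mem]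
    | succ n ih =>
      intro k w hw
      refine V.neg_mem (V.add_mem (ih k _ (hV w hw)) ?_)
      cases k with
      | zero =>
        rw [LinearMap.comp_apply, shift, Finsupp.lmapDomain_apply,
          Finsupp.mapDomain_of_notMem_range _ _ (by simp)]
        exact V.zero_mem
      | succ k =>
        rw [LinearMap.comp_apply, shift, Finsupp.lmapDomain_apply,
          Finsupp.mapDomain_apply Nat.succ_injective]
        exact ih k w hw
  simp only [subst, Finsupp.lsum_apply, Finsupp.sum, Finsupp.finsetSum_apply]
  exact V.sum_mem fun n _ => mono n k _ (hv n)

namespace ConformalProduct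

/-- A `λ`-product as a bilinear map into finitely supported sequences of coefficients. -/
def toBilin (m : ConformalProduct L) : L →ₗ[ℂ] L →ₗ[ℂ] (ℕ →₀ L) :=
  LinearMap.mk₂ ℂ
    (fun a b => Finsupp.ofSupportFinite (fun n => m.coeff n a b) <| by
      obtain ⟨N, hN⟩ := m.coeff_finite a b
      exact (Set.finite_lt_nat N).subset fun n hn => not_le.1 fun h => hn (hN n h))
    (fun _ _ _ => by ext n; simp [Finsupp.ofSupportFinite_coe])
    (fun _ _ _ => by ext n; simp [Finsupp.ofSupportFinite_coe])
    (fun _ _ _ => by ext n; simp [Finsupp.ofSupportFinite_coe])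
    (fun _ _ _ => by ext n; simp [Finsupp.ofSupportFinite_coe])

theorem toBilin_apply (m : ConformalProduct L) (a b : L) (n : ℕ) :
    m.toBilin a b n = m.coeff n a b := rfl

/-- The `λ`-product with prescribed sequences of coefficients. -/
def ofBilin (Q : L →ₗ[ℂ] L →ₗ[ℂ] (ℕ →₀ L)) : ConformalProduct L where
  coeff n := Q.compr₂ (Finsupp.lapply n)
  coeff_finite a b := by
    refine ⟨(Q a b).support.sup id + 1, fun n hn => ?_⟩
    refine Finsupp.notMem_support_iff.1 fun h => ?_
    have : n ≤ (Q a b).support.sup id := Finset.le_sup (f := id) h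
    omega

theorem toBilin_ofBilin (Q : L →ₗ[ℂ] L →ₗ[ℂ] (ℕ →₀ L)) : (ofBilin Q).toBilin = Q := by
  ext a b n
  rfl

end ConformalProduct

/-- The value of a bilinear product at `λ = x`, where `x ∈ ℂ[∂]` acts on the result. -/
def prodAt (Q : L →ₗ[ℂ] L →ₗ[ℂ] (ℕ →₀ L)) (x : ℂ[X]) : L →ₗ[ℂ] L →ₗ[ℂ] L :=
  Q.compr₂ (evalMap x LinearMap.id)

theorem prodAt_apply (Q : L →ₗ[ℂ] L →ₗ[ℂ] (ℕ →₀ L)) (x : ℂ[X]) (a b : L) :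
    prodAt Q x a b = evalMap x LinearMap.id (Q a b) := rfl

theorem finsum_pow_smul (x : ℂ[X]) (v : ℕ →₀ L) :
    ∑ᶠ n : ℕ, x ^ n • v n = evalMap x LinearMap.id v := by
  rw [finsum_eq_sum_of_support_subset (s := v.support)]
  · rfl
  · intro n hn
    rw [Finset.mem_coe, Finsupp.mem_support_iff]
    intro h
    exact hn (by simp only [h, smul_zero])

theorem ConformalProduct.mul_eq (m : ConformalProduct L) (r : ℂ) (a b : L) :
    m.mul r a b = prodAt m.toBilin (C r) a b := by
  rw [prodAt_apply, ← finsum_pow_smul, ConformalProduct.mul]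
  simp only [← C_pow, C_smul_eq, toBilin_apply]

theorem ConformalProduct.cmul_eq (m : ConformalProduct L) (r : ℂ) (a b : L) :
    m.cmul r a b = prodAt m.toBilin (-(X + C r)) a b := by
  rw [prodAt_apply, ← finsum_pow_smul, ConformalProduct.cmul]
  rfl

/-- The product `a ∘_λ (b ∘_μ c)` at `λ = x`, `μ = y`, with `x, y ∈ ℂ[∂]` acting on the result. -/
def nestR (Q₁ Q₂ : L →ₗ[ℂ] L →ₗ[ℂ] (ℕ →₀ L)) (x y : ℂ[X]) (a b c : L) : L :=
  evalMap y (prodAt Q₁ x a) (Q₂ b c)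

/-- The product `(a ∘_λ b) ∘_{λ+μ} c` at `λ = x`, `μ = y`, with `x, y ∈ ℂ[∂]` acting on the
result. -/
def nestL (Q₁ Q₂ : L →ₗ[ℂ] L →ₗ[ℂ] (ℕ →₀ L)) (x y : ℂ[X]) (a b c : L) : L :=
  evalMap x ((prodAt Q₁ (x + y)).flip c) (Q₂ a b)

section Nested

variable {Q Q₁ Q₂ : L →ₗ[ℂ] L →ₗ[ℂ] (ℕ →₀ L)}

theorem map_evalMap_C (f : L →ₗ[ℂ] L) (r : ℂ) (v : ℕ →₀ L) :
    f (evalMap (C r) LinearMap.id v) = evalMap (C r) f v := by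
  induction v using Finsupp.induction_linear with
  | zero => simp
  | add u v hu hv => simp only [map_add, hu, hv]
  | single n v => simp only [evalMap_single, ← C_pow, C_smul_eq, map_smul, LinearMap.id_apply]

theorem mul_mul_eq_nestR (m₁ m₂ : ConformalProduct L) (r s : ℂ) (a b c : L) :
    m₁.mul r a (m₂.mul s b c) = nestR m₁.toBilin m₂.toBilin (C r) (C s) a b c := by
  rw [m₁.mul_eq, m₂.mul_eq, prodAt_apply m₂.toBilin, map_evalMap_C, nestR]

theorem mul_mul_eq_nestL (m₁ m₂ : ConformalProduct L) (r s : ℂ) (a b c : L) :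
    m₁.mul (r + s) (m₂.mul r a b) c = nestL m₁.toBilin m₂.toBilin (C r) (C s) a b c := by
  rw [m₁.mul_eq, m₂.mul_eq, prodAt_apply m₂.toBilin, C_add]
  exact map_evalMap_C ((prodAt m₁.toBilin (C r + C s)).flip c) r _

theorem isPoly_prodAt (a b : L) : IsPoly fun x => prodAt Q x a b :=
  ⟨Q a b, fun _ => rfl⟩

/-- A function of two arguments in `ℂ[∂]` that is polynomial in each of them. -/
def IsPoly₂ (f : ℂ[X] → ℂ[X] → L) : Prop :=
  (∀ y, IsPoly fun x => f x y) ∧ ∀ x, IsPoly fun y => f x y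

namespace IsPoly₂

theorem sub {f g : ℂ[X] → ℂ[X] → L} (hf : IsPoly₂ f) (hg : IsPoly₂ g) :
    IsPoly₂ fun x y => f x y - g x y :=
  ⟨fun y => (hf.1 y).sub (hg.1 y), fun x => (hf.2 x).sub (hg.2 x)⟩

theorem csmul {f : ℂ[X] → ℂ[X] → L} (hf : IsPoly₂ f) (s : ℂ) :
    IsPoly₂ fun x y => s • f x y :=
  ⟨fun y => (hf.1 y).csmul s, fun x => (hf.2 x).csmul s⟩

theorem swap {f : ℂ[X] → ℂ[X] → L} (hf : IsPoly₂ f) : IsPoly₂ fun x y => f y x :=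
  ⟨hf.2, hf.1⟩

theorem eq_of_forall_C {f g : ℂ[X] → ℂ[X] → L} (hf : IsPoly₂ f) (hg : IsPoly₂ g)
    (h : ∀ r s : ℂ, f (C r) (C s) = g (C r) (C s)) (x y : ℂ[X]) : f x y = g x y :=
  (hf.2 x).eq_of_forall_C (hg.2 x)
    (fun s => (hf.1 (C s)).eq_of_forall_C (hg.1 (C s)) (fun r => h r s) x) y

theorem nestR (a b c : L) : IsPoly₂ fun x y => nestR Q₁ Q₂ x y a b c :=
  ⟨fun _ => IsPoly.evalMap (fun _ hg => hg.const_smul _) (fun v => isPoly_prodAt a v) _,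
    fun _ => IsPoly.evalMap (fun _ hg => hg.self_smul) (fun _ => IsPoly.const _) _⟩

theorem nestL (a b c : L) : IsPoly₂ fun x y => nestL Q₁ Q₂ x y a b c := by
  refine ⟨fun y => IsPoly.evalMap (fun _ hg => hg.self_smul)
      (F := fun x => (prodAt Q₁ (x + y)).flip c) (fun v => ?_) _,
    fun x => IsPoly.evalMap (fun _ hg => hg.const_smul _)
      (F := fun y => (prodAt Q₁ (x + y)).flip c) (fun v => ?_) _⟩
  · exact IsPoly.evalMap (fun _ hg => hg.add_smul y) (fun w => IsPoly.const w) (Q₁ v c)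
  · simp only [add_comm x]
    exact IsPoly.evalMap (fun _ hg => hg.add_smul x) (fun w => IsPoly.const w) (Q₁ v c)

end IsPoly₂

/-- Conformal sesquilinearity at all `x ∈ ℂ[∂]`. -/
structure IsSesq (Q : L →ₗ[ℂ] L →ₗ[ℂ] (ℕ →₀ L)) : Prop where
  left : ∀ (x : ℂ[X]) (a b : L), prodAt Q x ((X : ℂ[X]) • a) b = (-x) • prodAt Q x a b
  right : ∀ (x : ℂ[X]) (a b : L), prodAt Q x a ((X : ℂ[X]) • b) = (X + x) • prodAt Q x a b

theorem IsLambdaProduct.isSesq {S : SuperModule L} {m : ConformalProduct L}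
    (h : IsLambdaProduct S m) : IsSesq m.toBilin where
  left x a b := by
    refine IsPoly.eq_of_forall_C (isPoly_prodAt _ _)
      (g := fun x => (-x) • prodAt m.toBilin x a b) ?_ (fun r => ?_) x
    · simpa using (isPoly_prodAt a b).self_smul.csmul (-1)
    · have := h.sesq_left r a b
      rwa [m.mul_eq, m.mul_eq, ← C_smul_eq, C_neg] at this
  right x a b := by
    refine IsPoly.eq_of_forall_C (isPoly_prodAt _ _)
      (g := fun x => (X + x) • prodAt m.toBilin x a b) ?_ (fun r => ?_) x
    · simp only [add_comm X]
      exact (isPoly_prodAt a b).add_smul X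
    · have := h.sesq_right r a b
      rwa [m.mul_eq, m.mul_eq, ← C_smul_eq, ← add_smul] at this

/-- The opposite product `b ∘_{-∂-λ} a`. -/
def opp (Q : L →ₗ[ℂ] L →ₗ[ℂ] (ℕ →₀ L)) : L →ₗ[ℂ] L →ₗ[ℂ] (ℕ →₀ L) :=
  Q.flip.compr₂ subst

theorem prodAt_opp {x y : ℂ[X]} (h : x + y = -X) (a b : L) :
    prodAt (opp Q) x a b = prodAt Q y b a :=
  evalMap_subst (fun _ => rfl) h _

variable {x y z : ℂ[X]} (a b c : L)

theorem nestR_opp_right (h₁ : IsSesq Q₁) (h : x + y + z = -X) :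
    nestR Q₁ (opp Q₂) x y a b c = nestR Q₁ Q₂ x z a c b :=
  evalMap_subst (h₁.right x a) (by linear_combination h) _

theorem nestL_opp_right (h₁ : IsSesq Q₁) :
    nestL Q₁ (opp Q₂) x y a b c = nestL Q₁ Q₂ y x b a c := by
  rw [nestL, nestL, add_comm y x]
  exact evalMap_subst (r := -(x + y)) (fun v => h₁.left (x + y) v c) (by ring) _

theorem nestR_opp_left (h : x + y + z = -X) :
    nestR (opp Q₁) Q₂ x y a b c = nestL Q₁ Q₂ y z b c a := by
  have h' : x + (y + z) = -X := by rw [← h, add_assoc]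
  rw [nestR, nestL]
  refine evalMap_congr _ _ fun n => ?_
  rw [LinearMap.flip_apply, prodAt_opp h']

theorem nestL_opp_left (h : x + y + z = -X) :
    nestL (opp Q₁) Q₂ x y a b c = nestR Q₁ Q₂ z x c a b := by
  rw [nestR, nestL]
  refine evalMap_congr _ _ fun n => ?_
  rw [LinearMap.flip_apply, prodAt_opp h]

end Nested

theorem sgn_eq_one_or (i j : ZMod 2) : sgn i j = 1 ∨ sgn i j = -1 :=
  neg_one_pow_eq_or ℂ _

theorem sgn_comm (i j : ZMod 2) : sgn i j = sgn j i := by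
  rw [sgn, sgn, mul_comm]

theorem sgn_add_right (i j k : ZMod 2) : sgn i (j + k) = sgn i j * sgn i k := by
  rw [sgn, sgn, sgn, ← pow_add]
  refine neg_one_pow_congr ?_
  revert i j k
  decide

theorem sgn_add_left (i j k : ZMod 2) : sgn (i + j) k = sgn i k * sgn j k := by
  rw [sgn_comm, sgn_add_right, sgn_comm k i, sgn_comm k j]

theorem SuperModule.induction (S : SuperModule L) {P : L → Prop}
    (mem : ∀ i, ∀ a ∈ S.grade i, P a) (add : ∀ a b, P a → P b → P (a + b)) (a : L) : P a := by
  have ha : a ∈ ⨆ i, S.grade i := by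
    rw [DirectSum.IsInternal.submodule_iSup_eq_top S.isInternal]
    trivial
  exact Submodule.iSup_induction S.grade (motive := P) ha mem (mem 0 0 (S.grade 0).zero_mem) add

/-- The isomorphism of `L` with the external direct sum of its homogeneous components. -/
def SuperModule.equiv (S : SuperModule L) : (DirectSum (ZMod 2) fun i => S.grade i) ≃ₗ[ℂ] L :=
  LinearEquiv.ofBijective (DirectSum.coeLinearMap S.grade)
    (show Function.Bijective (DirectSum.coeLinearMap S.grade) from S.isInternal)

/-- The projection to the homogeneous component of parity `i`. -/
def SuperModule.proj (S : SuperModule L) (i : ZMod 2) : L →ₗ[ℂ] L :=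
  (S.grade i).subtype ∘ₗ DirectSum.component ℂ (ZMod 2) (fun i => S.grade i) i ∘ₗ
    S.equiv.symm.toLinearMap

theorem SuperModule.proj_of_mem (S : SuperModule L) {i : ZMod 2} {a : L} (ha : a ∈ S.grade i)
    (j : ZMod 2) : S.proj j a = if i = j then a else 0 := by
  have h : S.equiv.symm a =
      DirectSum.lof ℂ (ZMod 2) (fun i => S.grade i) i ⟨a, ha⟩ := by
    rw [LinearEquiv.symm_apply_eq, equiv, LinearEquiv.ofBijective_apply, DirectSum.coeLinearMap_lof]
  simp only [proj, LinearMap.comp_apply, LinearEquiv.coe_coe, h]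
  split_ifs with hij
  · subst hij
    simp [DirectSum.component.lof_self]
  · rw [DirectSum.component.of, dif_neg hij, map_zero]

/-- The super-commutator `a ∗_λ b - (-1)^{|a||b|} b ∗_{-∂-λ} a`, extended bilinearly. -/
def bracket (S : SuperModule L) (Q : L →ₗ[ℂ] L →ₗ[ℂ] (ℕ →₀ L)) :
    L →ₗ[ℂ] L →ₗ[ℂ] (ℕ →₀ L) :=
  Q - ∑ i, ∑ j, sgn i j • (opp Q).compl₁₂ (S.proj i) (S.proj j)

section Bracket

variable {S : SuperModule L} {Q Q₁ Q₂ : L →ₗ[ℂ] L →ₗ[ℂ] (ℕ →₀ L)} {i j k : ZMod 2} {a b c : L}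
  {x y z : ℂ[X]}

theorem bracket_of_mem (ha : a ∈ S.grade i) (hb : b ∈ S.grade j) :
    bracket S Q a b = Q a b - sgn i j • opp Q a b := by
  simp only [bracket, LinearMap.sub_apply, LinearMap.sum_apply, LinearMap.smul_apply,
    LinearMap.compl₁₂_apply]
  congr 1
  rw [Finset.sum_eq_single i, Finset.sum_eq_single j]
  · rw [S.proj_of_mem ha, S.proj_of_mem hb, if_pos rfl, if_pos rfl]
  · intro j' _ hj
    rw [S.proj_of_mem hb, if_neg hj.symm, map_zero, smul_zero]
  · simp
  · intro i' _ hi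
    rw [S.proj_of_mem ha, if_neg hi.symm]
    simp
  · simp

theorem prodAt_bracket (ha : a ∈ S.grade i) (hb : b ∈ S.grade j) (h : x + y = -X) :
    prodAt (bracket S Q) x a b = prodAt Q x a b - sgn i j • prodAt Q y b a := by
  rw [← prodAt_opp h, prodAt_apply, bracket_of_mem ha hb, map_sub, map_smul]
  rfl

theorem IsSesq.bracket (hQ : IsSesq Q) : IsSesq (bracket S Q) where
  left x a b := by
    induction a using S.induction with
    | add a a' h h' => simp only [smul_add, map_add, LinearMap.add_apply, h, h']
    | mem i a ha =>
    induction b using S.induction with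
    | add b b' h h' => simp only [smul_add, map_add, h, h']
    | mem j b hb =>
    have h : x + (-X - x) = -X := by ring
    rw [prodAt_bracket (S.X_smul_mem i a ha) hb h, prodAt_bracket ha hb h, hQ.left, hQ.right]
    module
  right x a b := by
    induction a using S.induction with
    | add a a' h h' => simp only [smul_add, map_add, LinearMap.add_apply, h, h']
    | mem i a ha =>
    induction b using S.induction with
    | add b b' h h' => simp only [smul_add, map_add, h, h']
    | mem j b hb =>
    have h : x + (-X - x) = -X := by ring
    rw [prodAt_bracket ha (S.X_smul_mem j b hb) h, prodAt_bracket ha hb h, hQ.left, hQ.right]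
    module

theorem nestR_bracket_right (h₁ : IsSesq Q₁) (hb : b ∈ S.grade j) (hc : c ∈ S.grade k)
    (h : x + y + z = -X) :
    nestR Q₁ (bracket S Q₂) x y a b c =
      nestR Q₁ Q₂ x y a b c - sgn j k • nestR Q₁ Q₂ x z a c b := by
  rw [← nestR_opp_right a b c h₁ h, nestR, bracket_of_mem hb hc, map_sub, map_smul]
  rfl

theorem nestL_bracket_right (h₁ : IsSesq Q₁) (ha : a ∈ S.grade i) (hb : b ∈ S.grade j) :
    nestL Q₁ (bracket S Q₂) x y a b c =
      nestL Q₁ Q₂ x y a b c - sgn i j • nestL Q₁ Q₂ y x b a c := by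
  rw [← nestL_opp_right a b c h₁, nestL, bracket_of_mem ha hb, map_sub, map_smul]
  rfl

theorem nestR_bracket_left (ha : a ∈ S.grade i) (h₂ : ∀ n, Q₂ b c n ∈ S.grade j)
    (h : x + y + z = -X) :
    nestR (bracket S Q₁) Q₂ x y a b c =
      nestR Q₁ Q₂ x y a b c - sgn i j • nestL Q₁ Q₂ y z b c a := by
  rw [← nestR_opp_left a b c h]
  simp only [nestR]
  rw [← evalMap_smul, ← evalMap_sub]
  refine evalMap_congr _ _ fun n => ?_
  rw [prodAt_apply, bracket_of_mem ha (h₂ n), map_sub, map_smul]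
  rfl

theorem nestL_bracket_left (h₂ : ∀ n, Q₂ a b n ∈ S.grade j) (hc : c ∈ S.grade k)
    (h : x + y + z = -X) :
    nestL (bracket S Q₁) Q₂ x y a b c =
      nestL Q₁ Q₂ x y a b c - sgn j k • nestR Q₁ Q₂ z x c a b := by
  rw [← nestL_opp_left a b c h]
  simp only [nestL]
  rw [← evalMap_smul, ← evalMap_sub]
  refine evalMap_congr _ _ fun n => ?_
  rw [LinearMap.flip_apply, prodAt_apply, bracket_of_mem (h₂ n) hc, map_sub, map_smul]
  rfl

theorem bracket_mem
    (hQ : ∀ (i j : ZMod 2) (a b : L), a ∈ S.grade i → b ∈ S.grade j →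
      ∀ n, Q a b n ∈ S.grade (i + j))
    (ha : a ∈ S.grade i) (hb : b ∈ S.grade j) (n : ℕ) :
    bracket S Q a b n ∈ S.grade (i + j) := by
  rw [bracket_of_mem ha hb]
  refine sub_mem (hQ i j a b ha hb n) ((S.grade (i + j)).smul_mem _ ?_)
  refine subst_mem (S.X_smul_mem (i + j)) (fun n => ?_) n
  rw [add_comm]
  exact hQ j i b a hb ha n

theorem nestR_add (Q₁ Q₂ : L →ₗ[ℂ] L →ₗ[ℂ] (ℕ →₀ L)) (x y : ℂ[X]) (a b c c' : L) :
    nestR Q₁ Q₂ x y a b (c + c') = nestR Q₁ Q₂ x y a b c + nestR Q₁ Q₂ x y a b c' := by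
  simp only [nestR, map_add]

theorem nestL_add (Q₁ Q₂ : L →ₗ[ℂ] L →ₗ[ℂ] (ℕ →₀ L)) (x y : ℂ[X]) (a b c c' : L) :
    nestL Q₁ Q₂ x y a b (c + c') = nestL Q₁ Q₂ x y a b c + nestL Q₁ Q₂ x y a b c' := by
  simp only [nestL, map_add, evalMap_add]

end Bracket

section Axioms

variable {S : SuperModule L} {m p : ConformalProduct L} {i j k : ZMod 2} {a b c : L}
  {x y z : ℂ[X]}

theorem IsLeftSymmetric.nest (hp : IsLeftSymmetric S p) (ha : a ∈ S.grade i)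
    (hb : b ∈ S.grade j) (c : L) (x y : ℂ[X]) :
    nestL p.toBilin p.toBilin x y a b c - nestR p.toBilin p.toBilin x y a b c =
      sgn i j • (nestL p.toBilin p.toBilin y x b a c -
        nestR p.toBilin p.toBilin y x b a c) := by
  refine IsPoly₂.eq_of_forall_C ((IsPoly₂.nestL a b c).sub (IsPoly₂.nestR a b c))
    (((IsPoly₂.nestL b a c).sub (IsPoly₂.nestR b a c)).swap.csmul (sgn i j)) (fun r s => ?_) x y
  have := hp.leftSym i j a b ha hb c r s
  rwa [mul_mul_eq_nestL, mul_mul_eq_nestR, add_comm r s, mul_mul_eq_nestL,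
    mul_mul_eq_nestR] at this

theorem IsNovikovPoisson.nest_compat₁ (h : IsNovikovPoisson S m p) (a b c : L) (x y : ℂ[X]) :
    nestL p.toBilin m.toBilin x y a b c = nestR m.toBilin p.toBilin x y a b c := by
  refine IsPoly₂.eq_of_forall_C (IsPoly₂.nestL a b c) (IsPoly₂.nestR a b c) (fun r s => ?_) x y
  rw [← mul_mul_eq_nestL, ← mul_mul_eq_nestR, h.compat₁]

theorem IsNovikovPoisson.nest_compat₂ (h : IsNovikovPoisson S m p) (ha : a ∈ S.grade i)
    (hb : b ∈ S.grade j) (c : L) (x y : ℂ[X]) :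
    nestL m.toBilin p.toBilin x y a b c - nestR p.toBilin m.toBilin x y a b c =
      sgn i j • (nestL m.toBilin p.toBilin y x b a c -
        nestR p.toBilin m.toBilin y x b a c) := by
  refine IsPoly₂.eq_of_forall_C ((IsPoly₂.nestL a b c).sub (IsPoly₂.nestR a b c))
    (((IsPoly₂.nestL b a c).sub (IsPoly₂.nestR b a c)).swap.csmul (sgn i j)) (fun r s => ?_) x y
  have := h.compat₂ i j a b ha hb c r s
  rwa [mul_mul_eq_nestL, mul_mul_eq_nestR, add_comm r s, mul_mul_eq_nestL,
    mul_mul_eq_nestR] at this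

theorem IsCommAssoc.toBilin_comm (hm : IsCommAssoc S m) (ha : a ∈ S.grade i)
    (hb : b ∈ S.grade j) : m.toBilin a b = sgn i j • opp m.toBilin a b := by
  rw [← sub_eq_zero]
  refine eq_zero_of_evalMap_C _ fun r => ?_
  have := hm.comm i j a b ha hb r
  rw [m.mul_eq, m.cmul_eq, ← prodAt_opp (x := C r) (y := -(X + C r)) (by ring)] at this
  rw [map_sub, map_smul, sub_eq_zero]
  exact this

theorem IsCommAssoc.nestR_comm (hm : IsCommAssoc S m) {Q : L →ₗ[ℂ] L →ₗ[ℂ] (ℕ →₀ L)}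
    (hQ : IsSesq Q) (a : L) (hb : b ∈ S.grade j) (hc : c ∈ S.grade k) (h : x + y + z = -X) :
    nestR Q m.toBilin x y a b c = sgn j k • nestR Q m.toBilin x z a c b := by
  rw [← nestR_opp_right a b c hQ h, nestR, hm.toBilin_comm hb hc, map_smul]
  rfl

theorem IsCommAssoc.nestL_comm (hm : IsCommAssoc S m) {Q : L →ₗ[ℂ] L →ₗ[ℂ] (ℕ →₀ L)}
    (hQ : IsSesq Q) (ha : a ∈ S.grade i) (hb : b ∈ S.grade j) (c : L) (x y : ℂ[X]) :
    nestL Q m.toBilin x y a b c = sgn i j • nestL Q m.toBilin y x b a c := by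
  rw [← nestL_opp_right a b c hQ, nestL, hm.toBilin_comm ha hb, map_smul]
  rfl

theorem IsCommAssoc.nestL_comm_outer (hm : IsCommAssoc S m)
    {Q : L →ₗ[ℂ] L →ₗ[ℂ] (ℕ →₀ L)} (hQ : ∀ n, Q a b n ∈ S.grade j) (hc : c ∈ S.grade k)
    (h : x + y + z = -X) :
    nestL m.toBilin Q x y a b c = sgn j k • nestR m.toBilin Q z x c a b := by
  rw [← nestL_opp_left a b c h]
  simp only [nestL]
  rw [← evalMap_smul]
  refine evalMap_congr _ _ fun n => ?_
  rw [LinearMap.flip_apply, prodAt_apply, hm.toBilin_comm (hQ n) hc, map_smul]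
  rfl

theorem IsNovikovPoisson.nestL_eq_nestR (h : IsNovikovPoisson S m p) (ha : a ∈ S.grade i)
    (hb : b ∈ S.grade j) (hc : c ∈ S.grade k) (hx : x + y + z = -X) :
    nestL m.toBilin p.toBilin x y a b c =
      sgn j k • nestR m.toBilin p.toBilin x z a c b := by
  rw [h.commAssoc.nestL_comm_outer (h.novikov.even i j a b ha hb) hc hx, ← h.nest_compat₁,
    h.commAssoc.nestL_comm h.novikov.isSesq hc ha, h.nest_compat₁, smul_smul, sgn_add_left,
    sgn_comm k i]
  congr 1
  rcases sgn_eq_one_or i k with hs | hs <;> rw [hs] <;> ring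

theorem nest_bracket_jacobi (hp : IsLeftSymmetric S p) (ha : a ∈ S.grade i)
    (hb : b ∈ S.grade j) (c : L) (x y : ℂ[X]) :
    nestR (bracket S p.toBilin) (bracket S p.toBilin) x y a b c =
      nestL (bracket S p.toBilin) (bracket S p.toBilin) x y a b c +
        sgn i j • nestR (bracket S p.toBilin) (bracket S p.toBilin) y x b a c := by
  induction c using S.induction with
  | add c c' h h' => simp only [nestR_add, nestL_add, h, h', smul_add]; abel
  | mem k c hc =>
  obtain ⟨z, h⟩ : ∃ z : ℂ[X], x + y + z = -X := ⟨-X - x - y, by ring⟩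
  have h_xzy : x + z + y = -X := by rw [← h]; ring
  have h_yxz : y + x + z = -X := by rw [← h]; ring
  have h_yzx : y + z + x = -X := by rw [← h]; ring
  have h_zxy : z + x + y = -X := by rw [← h]; ring
  have hQ : IsSesq p.toBilin := hp.isSesq
  rw [nestR_bracket_left ha (bracket_mem hp.even hb hc) h,
    nestR_bracket_right hQ hb hc h, nestL_bracket_right hQ hb hc,
    nestL_bracket_left (bracket_mem hp.even ha hb) hc h,
    nestL_bracket_right hQ ha hb, nestR_bracket_right hQ ha hb h_zxy,
    nestR_bracket_left hb (bracket_mem hp.even ha hc) h_yxz,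
    nestR_bracket_right hQ ha hc h_yxz, nestL_bracket_right hQ ha hc,
    sgn_add_left, sgn_add_right, sgn_add_right, sgn_comm j i]
  have E₁ := hp.nest ha hb c x y
  have E₂ := hp.nest ha hc b x z
  have E₃ := hp.nest hb hc a y z
  have E₂' := congrArg (sgn j k • ·) E₂
  have E₃' := congrArg ((sgn i j * sgn i k) • ·) E₃
  have hs := sgn_eq_one_or i j
  have ht := sgn_eq_one_or j k
  have hu := sgn_eq_one_or i k
  generalize sgn i j = s, sgn j k = t, sgn i k = u at *
  rcases hs with rfl | rfl <;> rcases ht with rfl | rfl <;> rcases hu with rfl | rfl <;>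
    linear_combination (norm := module) E₂' - E₁ - E₃'

theorem IsNovikovPoisson.nest_transposedLeibniz (h : IsNovikovPoisson S m p)
    (ha : a ∈ S.grade i) (hb : b ∈ S.grade j) (c : L) (x y : ℂ[X]) :
    (2 : ℂ) • nestR m.toBilin (bracket S p.toBilin) x y a b c =
      nestL (bracket S p.toBilin) m.toBilin x y a b c +
        sgn i j • nestR (bracket S p.toBilin) m.toBilin y x b a c := by
  induction c using S.induction with
  | add c c' h h' => simp only [nestR_add, nestL_add, h, h', smul_add]; abel
  | mem k c hc =>
  obtain ⟨z, hx⟩ : ∃ z : ℂ[X], x + y + z = -X := ⟨-X - x - y, by ring⟩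
  have h_xzy : x + z + y = -X := by rw [← hx]; ring
  have h_yxz : y + x + z = -X := by rw [← hx]; ring
  have h_zxy : z + x + y = -X := by rw [← hx]; ring
  have hm := h.commAssoc
  have K₁ := h.nest_compat₂ ha hb c x y
  have K₂ := h.nest_compat₂ ha hc b x z
  have C₀ := hm.nestR_comm h.novikov.isSesq a hb hc hx
  have F := hm.nestL_comm h.novikov.isSesq hb hc a y z
  rw [h.nestL_eq_nestR ha hb hc hx, h.nestL_eq_nestR hb ha hc h_yxz] at K₁
  rw [h.nestL_eq_nestR ha hc hb h_xzy, h.nestL_eq_nestR hc ha hb h_zxy, sgn_comm k j] at K₂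
  rw [h.nest_compat₁, h.nest_compat₁] at F
  rw [nestR_bracket_right hm.isSesq hb hc hx, nestL_bracket_left (hm.even i j a b ha hb) hc hx,
    nestR_bracket_left hb (hm.even i k a c ha hc) h_yxz, h.nest_compat₁, h.nest_compat₁,
    sgn_add_left, sgn_add_right, sgn_comm j i]
  have K₂' := congrArg (sgn j k • ·) K₂
  have F' := congrArg ((sgn i j * sgn i k) • ·) F
  have hs := sgn_eq_one_or i j
  have ht := sgn_eq_one_or j k
  have hu := sgn_eq_one_or i k
  generalize sgn i j = s, sgn j k = t, sgn i k = u at *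
  rcases hs with rfl | rfl <;> rcases ht with rfl | rfl <;> rcases hu with rfl | rfl <;>
    linear_combination (norm := module) K₂' - K₁ - C₀ - F'

end Axioms

/-- the commutator bracket
`[a_λ b] = a ∗_λ b - (-1)^{|a||b|} (b ∗_{-∂-λ} a)` of a Novikov-Poisson conformal
superalgebra makes it a transposed Poisson conformal superalgebra. -/
theorem statement_11 (S : SuperModule L) (mc p : ConformalProduct L)
    (hNP : IsNovikovPoisson S mc p) :
    ∃ br : ConformalProduct L,
      (∀ (i j : ZMod 2) (a b : L), a ∈ S.grade i → b ∈ S.grade j →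
        ∀ lam : ℂ, br.mul lam a b = p.mul lam a b - sgn i j • p.cmul lam b a) ∧
      IsTPCSA S mc br := by
  have toBilin_br := ConformalProduct.toBilin_ofBilin (bracket S p.toBilin)
  have hQ : IsSesq p.toBilin := hNP.novikov.isSesq
  have mul_br : ∀ (i j : ZMod 2) (a b : L), a ∈ S.grade i → b ∈ S.grade j → ∀ lam : ℂ,
      (ConformalProduct.ofBilin (bracket S p.toBilin)).mul lam a b =
        p.mul lam a b - sgn i j • p.cmul lam b a := by
    intro i j a b ha hb lam
    rw [ConformalProduct.mul_eq, ConformalProduct.mul_eq, ConformalProduct.cmul_eq, toBilin_br,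
      prodAt_bracket ha hb (y := -(X + C lam)) (by ring)]
  refine ⟨.ofBilin (bracket S p.toBilin), mul_br, hNP.commAssoc,
    ⟨⟨fun i j a b ha hb n => bracket_mem hNP.novikov.even ha hb n, ?_, ?_⟩, ?_, ?_⟩, ?_⟩
  · intro lam a b
    rw [ConformalProduct.mul_eq, ConformalProduct.mul_eq, toBilin_br, hQ.bracket.left, ← C_neg,
      C_smul_eq]
  · intro lam a b
    rw [ConformalProduct.mul_eq, ConformalProduct.mul_eq, toBilin_br, hQ.bracket.right,
      add_smul, C_smul_eq]
  · intro i j a b ha hb lam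
    rw [ConformalProduct.mul_eq, ConformalProduct.cmul_eq, toBilin_br,
      prodAt_bracket ha hb (y := -(X + C lam)) (by ring),
      prodAt_bracket hb ha (y := C lam) (by ring), sgn_comm j i]
    rcases sgn_eq_one_or i j with s | s <;> rw [s] <;> module
  · intro i j a b ha hb c lam mu
    rw [mul_mul_eq_nestR, mul_mul_eq_nestL, mul_mul_eq_nestR, toBilin_br]
    exact nest_bracket_jacobi hNP.novikov.toIsLeftSymmetric ha hb c _ _
  · intro i j a b ha hb c lam mu
    rw [mul_mul_eq_nestR, mul_mul_eq_nestL, mul_mul_eq_nestR, toBilin_br]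
    exact hNP.nest_transposedLeibniz ha hb c _ _

end TPCSAFormal
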